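/- Let ξ = exp(2πi/11), ν = (−1+i√11)/2, ℤ[ν] = {a + bν : a, b ∈ ℤ} ⊂ ℂ, for k ∈ ℤ let v_k = (ξ^k, ξ^{9k}, ξ^{3k}, ξ^{4k}, ξ^{5k}) ∈ ℂ⁵, and let Λ₂ = ℤ[ν]·(v₀−3v₁+3v₂−v₃)/(1+2ν) + ℤ[ν]·(v₁−3v₂+3v₃−v₄)/(1+2ν) + ℤ[ν]v₀ + ℤ[ν]v₁ + ℤ[ν]v₂. Then there exist vectors b₁, …, b₅ ∈ ℂ⁵ forming a ℂ-basis of ℂ⁵ such that Λ₂ = ℤ[ν]b₁ + ℤ[ν]b₂ + ℤ[ν]b₃ + ℤ[ν]b₄ + ℤ[ν]b₅; equivalently, the complex torus ℂ⁵/Λ₂ is isomorphic to 𝔼⁵, where 𝔼 = ℂ/ℤ[ν]. -/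

import Mathlib

/-- ξ = exp(2πi/11), a primitive 11th root of unity. -/
noncomputable def ξ : ℂ := Complex.exp (2 * Real.pi * Complex.I / 11)

/-- ν = (−1 + i√11)/2. -/
noncomputable def ν : ℂ := (-1 + Complex.I * Real.sqrt 11) / 2

/-- ℤ[ν] = {a + bν : a, b ∈ ℤ} ⊂ ℂ. -/
noncomputable def Zν : Set ℂ := {z | ∃ a b : ℤ, z = (a : ℂ) + (b : ℂ) * ν}

/-- v_k = (ξ^k, ξ^{9k}, ξ^{3k}, ξ^{4k}, ξ^{5k}) ∈ ℂ⁵. -/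
noncomputable def v (k : ℕ) : Fin 5 → ℂ := fun i => ξ ^ (k * ![1, 9, 3, 4, 5] i)

/-- u₁ = (v₀ − 3v₁ + 3v₂ − v₃)/(1+2ν). -/
noncomputable def u₁ : Fin 5 → ℂ :=
  (1 / (1 + 2 * ν)) • (v 0 - (3 : ℂ) • v 1 + (3 : ℂ) • v 2 - v 3)

/-- u₂ = (v₁ − 3v₂ + 3v₃ − v₄)/(1+2ν). -/
noncomputable def u₂ : Fin 5 → ℂ :=
  (1 / (1 + 2 * ν)) • (v 1 - (3 : ℂ) • v 2 + (3 : ℂ) • v 3 - v 4)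

/-- The period lattice Λ₂ = ℤ[ν]u₁ + ℤ[ν]u₂ + ℤ[ν]v₀ + ℤ[ν]v₁ + ℤ[ν]v₂ ⊂ ℂ⁵. -/
noncomputable def Λ₂ : Set (Fin 5 → ℂ) :=
  {x | ∃ c : Fin 5 → ℂ, (∀ j, c j ∈ Zν) ∧ x = ∑ j : Fin 5, c j • ![u₁, u₂, v 0, v 1, v 2] j}

theorem isPrimitiveRoot_ξ : IsPrimitiveRoot ξ 11 := by
  simpa [ξ] using Complex.isPrimitiveRoot_exp 11 (by norm_num)

theorem one_add_two_mul_ν_ne_zero : 1 + 2 * ν ≠ 0 := by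
  have h : 1 + 2 * ν = Complex.I * Real.sqrt 11 := by
    rw [ν]
    ring
  rw [h]
  exact mul_ne_zero Complex.I_ne_zero
    (Complex.ofReal_ne_zero.mpr (Real.sqrt_ne_zero'.mpr (by norm_num)))

theorem injective_ξ_pow :
    Function.Injective fun i : Fin 5 => ξ ^ (![1, 9, 3, 4, 5] i : ℕ) := by
  intro i j hij
  have hlt : ∀ i : Fin 5, (![1, 9, 3, 4, 5] i : ℕ) < 11 := by decide
  have hinj : ∀ i j : Fin 5, (![1, 9, 3, 4, 5] i : ℕ) = ![1, 9, 3, 4, 5] j → i = j := by decide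
  exact hinj i j (isPrimitiveRoot_ξ.pow_inj (hlt i) (hlt j) hij)

/-- The vectors `v 0, …, v 4` are the columns of an invertible Vandermonde matrix. -/
theorem linearIndependent_v : LinearIndependent ℂ fun k : Fin 5 => v k := by
  rw [Fintype.linearIndependent_iff]
  intro c hc
  refine congrFun (Matrix.eq_zero_of_mulVec_eq_zero
    (Matrix.det_vandermonde_ne_zero_iff.mpr injective_ξ_pow) (v := c) ?_)
  ext i
  have h := congrFun hc i
  simp only [Finset.sum_apply, Pi.smul_apply, smul_eq_mul, v] at h
  simp only [Matrix.mulVec, dotProduct, Matrix.vandermonde_apply, ← pow_mul]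
  rw [← h]
  exact Finset.sum_congr rfl fun k _ => by rw [mul_comm, mul_comm (k : ℕ)]

theorem linearIndependent_generators : LinearIndependent ℂ ![u₁, u₂, v 0, v 1, v 2] := by
  have hs := one_add_two_mul_ν_ne_zero
  rw [Fintype.linearIndependent_iff]
  intro c hc
  set t : ℂ := 1 / (1 + 2 * ν) with ht
  have ht0 : t ≠ 0 := one_div_ne_zero hs
  have h := Fintype.linearIndependent_iff.mp linearIndependent_v
    ![t * c 0 + c 2, -3 * t * c 0 + t * c 1 + c 3, 3 * t * c 0 - 3 * t * c 1 + c 4,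
      -t * c 0 + 3 * t * c 1, -t * c 1] (by
    rw [← hc]
    ext i
    simp [Fin.sum_univ_five, u₁, u₂, -one_div, ← ht]
    ring)
  have h0 := h 0
  have h1 := h 1
  have h2 := h 2
  have h3 := h 3
  have h4 := h 4
  simp only [Matrix.cons_val] at h0 h1 h2 h3 h4
  have c1 : c 1 = 0 := by simpa [ht0] using h4
  have c0 : c 0 = 0 := by simpa [c1, ht0] using h3
  simp only [c0, c1, mul_zero, zero_add, sub_zero] at h0 h1 h2
  intro i
  fin_cases i <;> assumption

/-- there is a ℂ-basis b₁, …, b₅ of ℂ⁵ with Λ₂ = ℤ[ν]b₁ + … + ℤ[ν]b₅;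
equivalently, ℂ⁵/Λ₂ ≅ 𝔼⁵ with 𝔼 = ℂ/ℤ[ν]. -/
theorem Lambda2_free_Znu_module :
    ∃ b : Fin 5 → (Fin 5 → ℂ), LinearIndependent ℂ b ∧
      Λ₂ = {x | ∃ c : Fin 5 → ℂ, (∀ j, c j ∈ Zν) ∧ x = ∑ j : Fin 5, c j • b j} := by
  exact ⟨_, linearIndependent_generators, rfl⟩
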